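/- There exists a skew-Hadamard matrix of order 580; that is, there exists a 580 × 580 integer matrix M with all entries ±1 such that M · Mᵀ = 580 · I_580 and M + Mᵀ = 2 · I_580. -/

import Mathlib

open Matrix

section GoethalsSeidel

variable {G : Type*} [AddCommGroup G]

/-- The Goethals–Seidel array, with `a` defining the circulant diagonal blocks and `b`, `c`, `d`
the back-circulant blocks off the diagonal. -/
def goethalsSeidel (a b c d : G → ℤ) : Matrix (Fin 4 × G) (Fin 4 × G) ℤ :=
  Matrix.of fun p q =>
    let i := p.2
    let j := q.2
    !![a (j - i), b (i + j), c (i + j), d (i + j);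
       -b (i + j), a (j - i), d (-(i + j)), -c (-(i + j));
       -c (i + j), -d (-(i + j)), a (j - i), b (-(i + j));
       -d (i + j), c (-(i + j)), -b (-(i + j)), a (j - i)] p.1 q.1

theorem goethalsSeidel_eq_one_or {a b c d : G → ℤ} (ha : ∀ x, a x = 1 ∨ a x = -1)
    (hb : ∀ x, b x = 1 ∨ b x = -1) (hc : ∀ x, c x = 1 ∨ c x = -1)
    (hd : ∀ x, d x = 1 ∨ d x = -1) (p q : Fin 4 × G) :
    goethalsSeidel a b c d p q = 1 ∨ goethalsSeidel a b c d p q = -1 := by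
  have neg {x : ℤ} (h : x = 1 ∨ x = -1) : -x = 1 ∨ -x = -1 := by lia
  obtain ⟨r, i⟩ := p
  obtain ⟨s, j⟩ := q
  fin_cases r <;> fin_cases s <;>
    first
    | exact ha _
    | exact hb _
    | exact hc _
    | exact hd _
    | exact neg (hb _)
    | exact neg (hc _)
    | exact neg (hd _)

theorem goethalsSeidel_add_transpose [DecidableEq G] {a : G → ℤ} (b c d : G → ℤ)
    (ha : ∀ x, a x + a (-x) = if x = 0 then 2 else 0) :
    goethalsSeidel a b c d + (goethalsSeidel a b c d)ᵀ = (2 : ℤ) • 1 := by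
  ext ⟨r, i⟩ ⟨s, j⟩
  have h := ha (j - i)
  simp only [neg_sub, sub_eq_zero, eq_comm (a := j)] at h
  fin_cases r <;> fin_cases s <;>
    simp [goethalsSeidel, Matrix.one_apply, -neg_add_rev, add_comm j i, h]

variable [Fintype G]

/-- The periodic autocorrelation of `f` at shift `s`. -/
def periodicAutocorrelation (f : G → ℤ) (s : G) : ℤ := ∑ j, f j * f (j + s)

theorem sum_sub_mul_sub (f : G → ℤ) (i k : G) :
    ∑ j, f (j - i) * f (j - k) = periodicAutocorrelation f (i - k) :=
  Fintype.sum_equiv (Equiv.subRight i) _ _ fun j => by simp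

theorem sum_add_mul_add (f : G → ℤ) (i k : G) :
    ∑ j, f (i + j) * f (k + j) = periodicAutocorrelation f (i - k) :=
  Fintype.sum_equiv (Equiv.addLeft k) _ _ fun j => by
    rw [mul_comm, Equiv.coe_addLeft, show k + j + (i - k) = i + j by abel]

theorem sum_neg_add_mul_neg_add (f : G → ℤ) (i k : G) :
    ∑ j, f (-(i + j)) * f (-(k + j)) = periodicAutocorrelation f (i - k) :=
  Fintype.sum_equiv ((Equiv.addLeft i).trans (Equiv.neg G)) _ _ fun j => by
    simp only [Equiv.trans_apply, Equiv.coe_addLeft, Equiv.neg_apply]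
    rw [show -(i + j) + (i - k) = -(k + j) by abel]

theorem sum_sub_mul_add_comm (f g : G → ℤ) (i k : G) :
    ∑ j, f (j - i) * g (k + j) = ∑ j, g (i + j) * f (j - k) :=
  Fintype.sum_equiv (Equiv.addRight (k - i)) _ _ fun j => by
    rw [mul_comm, Equiv.coe_addRight, show i + (j + (k - i)) = k + j by abel,
      show j + (k - i) - k = j - i by abel]

theorem sum_add_mul_neg_add_comm (f g : G → ℤ) (i k : G) :
    ∑ j, f (i + j) * g (-(k + j)) = ∑ j, g (i + j) * f (-(k + j)) :=
  Fintype.sum_equiv ((Equiv.addLeft (i + k)).trans (Equiv.neg G)) _ _ fun j => by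
    simp only [Equiv.trans_apply, Equiv.coe_addLeft, Equiv.neg_apply]
    rw [mul_comm, show i + -(i + k + j) = -(k + j) by abel,
      show -(k + -(i + k + j)) = i + j by abel]

theorem sum_add_mul_add_comm (f g : G → ℤ) (i k : G) :
    ∑ j, f (i + j) * g (k + j) = ∑ j, g (-(i + j)) * f (-(k + j)) :=
  Fintype.sum_equiv ((Equiv.addLeft (i + k)).trans (Equiv.neg G)) _ _ fun j => by
    simp only [Equiv.trans_apply, Equiv.coe_addLeft, Equiv.neg_apply]
    rw [mul_comm, show -(i + -(i + k + j)) = k + j by abel,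
      show -(k + -(i + k + j)) = i + j by abel]

theorem goethalsSeidel_mul_transpose [DecidableEq G] {a b c d : G → ℤ} {m : ℤ}
    (h : ∀ s, periodicAutocorrelation a s + periodicAutocorrelation b s
      + periodicAutocorrelation c s + periodicAutocorrelation d s = if s = 0 then m else 0) :
    goethalsSeidel a b c d * (goethalsSeidel a b c d)ᵀ = m • 1 := by
  ext ⟨r, i⟩ ⟨s, k⟩
  have hik := h (i - k)
  simp only [sub_eq_zero] at hik
  have hab := sum_sub_mul_add_comm a b i k
  have hac := sum_sub_mul_add_comm a c i k
  have had := sum_sub_mul_add_comm a d i k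
  have hab' := sum_sub_mul_add_comm a (fun x => b (-x)) i k
  have hac' := sum_sub_mul_add_comm a (fun x => c (-x)) i k
  have had' := sum_sub_mul_add_comm a (fun x => d (-x)) i k
  have hbc := sum_add_mul_neg_add_comm b c i k
  have hbd := sum_add_mul_neg_add_comm b d i k
  have hcd := sum_add_mul_neg_add_comm c d i k
  have hbc' := sum_add_mul_neg_add_comm (fun x => b (-x)) (fun x => c (-x)) i k
  have hbd' := sum_add_mul_neg_add_comm (fun x => b (-x)) (fun x => d (-x)) i k
  have hcd' := sum_add_mul_neg_add_comm (fun x => c (-x)) (fun x => d (-x)) i k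
  have kbc := sum_add_mul_add_comm b c i k
  have kbd := sum_add_mul_add_comm b d i k
  have kcd := sum_add_mul_add_comm c d i k
  have kcb := sum_add_mul_add_comm c b i k
  have kdb := sum_add_mul_add_comm d b i k
  have kdc := sum_add_mul_add_comm d c i k
  simp only [neg_neg] at hbc' hbd' hcd'
  rw [Matrix.mul_apply, Fintype.sum_prod_type]
  fin_cases r <;> fin_cases s <;>
    simp [goethalsSeidel, Fin.sum_univ_four, Matrix.one_apply, -neg_add_rev,
      Finset.sum_neg_distrib, sum_sub_mul_sub, sum_add_mul_add, sum_neg_add_mul_neg_add] <;>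
    linarith

theorem exists_skew_hadamard_of_periodicAutocorrelation [DecidableEq G] {n : ℕ}
    (hn : 4 * Fintype.card G = n) {a b c d : G → ℤ}
    (ha : ∀ x, a x = 1 ∨ a x = -1) (hb : ∀ x, b x = 1 ∨ b x = -1)
    (hc : ∀ x, c x = 1 ∨ c x = -1) (hd : ∀ x, d x = 1 ∨ d x = -1)
    (hskew : ∀ x, a x + a (-x) = if x = 0 then 2 else 0)
    (h : ∀ s, periodicAutocorrelation a s + periodicAutocorrelation b s
      + periodicAutocorrelation c s + periodicAutocorrelation d s = if s = 0 then (n : ℤ) else 0) :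
    ∃ M : Matrix (Fin n) (Fin n) ℤ,
      (∀ i j, M i j = 1 ∨ M i j = -1) ∧ M * Mᵀ = (n : ℤ) • 1 ∧ M + Mᵀ = (2 : ℤ) • 1 := by
  let e : Fin n ≃ Fin 4 × G := (Fintype.equivFinOfCardEq (by simpa using hn)).symm
  refine ⟨(goethalsSeidel a b c d).submatrix e e,
    fun i j => goethalsSeidel_eq_one_or ha hb hc hd _ _, ?_, ?_⟩
  · rw [transpose_submatrix, submatrix_mul_equiv, goethalsSeidel_mul_transpose h,
      submatrix_smul, Pi.smul_apply, Pi.smul_apply, submatrix_one_equiv]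
  · rw [transpose_submatrix]
    change (goethalsSeidel a b c d + (goethalsSeidel a b c d)ᵀ).submatrix e e = _
    rw [goethalsSeidel_add_transpose b c d hskew,
      submatrix_smul, Pi.smul_apply, Pi.smul_apply, submatrix_one_equiv]

end GoethalsSeidel

/-- The `±1` sequence whose entry at `x` is `-1` exactly when bit `x` of `m` is set. -/
def bitSign (m : ℕ) (x : Fin 145) : ℤ := bif m.testBit x.val then -1 else 1

theorem bitSign_eq_one_or (m : ℕ) (x : Fin 145) : bitSign m x = 1 ∨ bitSign m x = -1 := by
  unfold bitSign
  cases m.testBit x.val <;> simp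

theorem exists_skew_hadamard_580 :
    ∃ M : Matrix (Fin 580) (Fin 580) ℤ,
      (∀ i j, M i j = 1 ∨ M i j = -1) ∧
      M * Mᵀ = (580 : ℤ) • 1 ∧
      M + Mᵀ = (2 : ℤ) • 1 := by
  refine exists_skew_hadamard_of_periodicAutocorrelation (G := Fin 145) (n := 580) (by simp)
    (a := bitSign 0x102fefb6d389d0ddd7985113d1b8d248202fc)
    (b := bitSign 0x94513faf4db93b5dc2bae23874caf2fc69e1)
    (c := bitSign 0x33609ec4d7ad9b7ae1ea62a97c91c2fbcc4f)
    (d := bitSign 0x1e50b650aa252b023125dc380867e1c45b733)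
    (bitSign_eq_one_or _) (bitSign_eq_one_or _) (bitSign_eq_one_or _) (bitSign_eq_one_or _) ?_ ?_
  · decide +kernel
  · decide +kernel
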